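/- Let A and B be infinite, non-isomorphic, computably presentable structures in the same language with A ≡₁ B (they satisfy the same existential sentences). Then {ω, ω*} ≤_tc {A, B}. -/

import Mathlib

/-- A finite piece of an atomic diagram of a structure in a language with one
binary relation, with domain a finite set of naturals. -/
structure FinD where
  dom : Finset ℕ
  rel : ℕ → ℕ → Prop

/-- `β` extends `α` as a finite atomic diagram. -/
def FinD.Ext (α β : FinD) : Prop :=
  α.dom ⊆ β.dom ∧ ∀ x ∈ α.dom, ∀ y ∈ α.dom, (α.rel x y ↔ β.rel x y)

/-- An enumeration operator: it monotonically enumerates membership facts,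
positive atomic facts `R(x, y)` and negative atomic facts `¬ R(x, y)`. -/
structure EOp where
  mem : FinD → Set ℕ
  pos : FinD → Set (ℕ × ℕ)
  neg : FinD → Set (ℕ × ℕ)
  mono_mem : ∀ {α β : FinD}, α.Ext β → mem α ⊆ mem β
  mono_pos : ∀ {α β : FinD}, α.Ext β → pos α ⊆ pos β
  mono_neg : ∀ {α β : FinD}, α.Ext β → neg α ⊆ neg β

/-- A (possibly infinite) diagram with domain a set of naturals. -/
structure Diag where
  dom : Set ℕ
  rel : ℕ → ℕ → Prop

/-- `α` is a finite subdiagram of `L`. -/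
def FinD.SubDiag (α : FinD) (L : Diag) : Prop :=
  ↑α.dom ⊆ L.dom ∧ ∀ x ∈ α.dom, ∀ y ∈ α.dom, (α.rel x y ↔ L.rel x y)

/-- Membership facts enumerated by `Γ` on the diagram `L`. -/
def EOp.memD (Γ : EOp) (L : Diag) : Set ℕ :=
  {x | ∃ α : FinD, α.SubDiag L ∧ x ∈ Γ.mem α}

/-- Positive facts enumerated by `Γ` on the diagram `L`. -/
def EOp.posD (Γ : EOp) (L : Diag) : Set (ℕ × ℕ) :=
  {p | ∃ α : FinD, α.SubDiag L ∧ p ∈ Γ.pos α}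

/-- Negative facts enumerated by `Γ` on the diagram `L`. -/
def EOp.negD (Γ : EOp) (L : Diag) : Set (ℕ × ℕ) :=
  {p | ∃ α : FinD, α.SubDiag L ∧ p ∈ Γ.neg α}

/-- `L` is (the atomic diagram of) a copy of the structure `(τ, r)`. -/
def IsCopyR {τ : Type} (r : τ → τ → Prop) (L : Diag) : Prop :=
  ∃ f : τ → ℕ, Function.Injective f ∧ Set.range f = L.dom ∧
    ∀ i j : τ, (L.rel (f i) (f j) ↔ r i j)

/-- The output of `Γ` on `L` is (the atomic diagram of) a copy of `(σ, s)`. -/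
def EOp.OutCopyR {σ : Type} (Γ : EOp) (s : σ → σ → Prop) (L : Diag) : Prop :=
  ∃ g : σ → ℕ, Function.Injective g ∧ Γ.memD L = Set.range g ∧
    (∀ a b : σ, ((g a, g b) ∈ Γ.posD L ↔ s a b)) ∧
    (∀ a b : σ, ((g a, g b) ∈ Γ.negD L ↔ ¬ s a b))

/-- `{A₁, A₂} ≤_c {B₁, B₂}` : there is an enumeration operator mapping every
copy of `A₁` to a copy of `B₁` and every copy of `A₂` to a copy of `B₂`. -/
def PairLE {τ₁ τ₂ σ₁ σ₂ : Type} (r₁ : τ₁ → τ₁ → Prop) (r₂ : τ₂ → τ₂ → Prop)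
    (s₁ : σ₁ → σ₁ → Prop) (s₂ : σ₂ → σ₂ → Prop) : Prop :=
  ∃ Γ : EOp, (∀ L : Diag, IsCopyR r₁ L → Γ.OutCopyR s₁ L) ∧
    (∀ L : Diag, IsCopyR r₂ L → Γ.OutCopyR s₂ L)

/-- The equivalence structure `E` with infinitely many infinite classes and no
finite classes: classes are the columns of `ℕ × ℕ`. -/
def relE : ℕ × ℕ → ℕ × ℕ → Prop := fun p q => p.1 = q.1

/-- The equivalence structure `E_k` with infinitely many infinite classes and
exactly one class of size `k`. -/
def relEk (k : ℕ) : (ℕ × ℕ) ⊕ Fin k → (ℕ × ℕ) ⊕ Fin k → Prop := fun x y =>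
  match x, y with
  | Sum.inl p, Sum.inl q => p.1 = q.1
  | Sum.inr _, Sum.inr _ => True
  | _, _ => False

/-- The equivalence structure `Ê_k` with infinitely many infinite classes and
infinitely many classes of size exactly `k`. -/
def relEhat (k : ℕ) : (ℕ × ℕ) ⊕ (ℕ × Fin k) → (ℕ × ℕ) ⊕ (ℕ × Fin k) → Prop := fun x y =>
  match x, y with
  | Sum.inl p, Sum.inl q => p.1 = q.1
  | Sum.inr p, Sum.inr q => p.1 = q.1
  | _, _ => False

/-- The code of the atomic diagram of `L` as a set of naturals: `2 * x` codes
`x ∈ dom`, and `2 * ⟨x, y⟩ + 1` codes the fact `R(x, y)` (for `x, y ∈ dom`). -/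
def DiagCode (L : Diag) : Set ℕ :=
  {n | (¬ Odd n ∧ n / 2 ∈ L.dom) ∨
       (Odd n ∧ (Nat.unpair (n / 2)).1 ∈ L.dom ∧ (Nat.unpair (n / 2)).2 ∈ L.dom ∧
         L.rel (Nat.unpair (n / 2)).1 (Nat.unpair (n / 2)).2)}

/-- `X` is the characteristic function of the atomic diagram of `L`. -/
def CharOf (L : Diag) (X : ℕ → Bool) : Prop :=
  ∀ n, X n = true ↔ n ∈ DiagCode L

/-- A Turing operator, presented by a computable monotone functional on finite
strings of oracle answers. -/
structure TOp where
  φ : List Bool → ℕ → Option Bool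
  computable : Computable₂ φ
  mono : ∀ (σ τ : List Bool) (n : ℕ) (b : Bool), σ <+: τ → φ σ n = some b → φ τ n = some b

/-- `σ` is a string of initial answers of the oracle `X`. -/
def Agrees (X : ℕ → Bool) (σ : List Bool) : Prop :=
  ∀ (i : ℕ) (h : i < σ.length), σ.get ⟨i, h⟩ = X i

/-- `Y` is the (total) output of the Turing operator `T` on oracle `X`. -/
def TOp.Sends (T : TOp) (X Y : ℕ → Bool) : Prop :=
  ∀ n, ∃ σ : List Bool, Agrees X σ ∧ T.φ σ n = some (Y n)

/-- `{A₁, A₂} ≤_tc {B₁, B₂}` with the fixed pairing `A₁ ↦ B₁`, `A₂ ↦ B₂`: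
a single Turing operator maps the diagram of any copy of `Aᵢ` to the diagram
of a copy of `Bᵢ`. -/
def TcPair {τ₁ τ₂ σ₁ σ₂ : Type} (r₁ : τ₁ → τ₁ → Prop) (r₂ : τ₂ → τ₂ → Prop)
    (s₁ : σ₁ → σ₁ → Prop) (s₂ : σ₂ → σ₂ → Prop) : Prop :=
  ∃ T : TOp,
    (∀ (L : Diag) (X : ℕ → Bool), IsCopyR r₁ L → CharOf L X →
      ∃ (M : Diag) (Y : ℕ → Bool), IsCopyR s₁ M ∧ CharOf M Y ∧ T.Sends X Y) ∧
    (∀ (L : Diag) (X : ℕ → Bool), IsCopyR r₂ L → CharOf L X →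
      ∃ (M : Diag) (Y : ℕ → Bool), IsCopyR s₂ M ∧ CharOf M Y ∧ T.Sends X Y)

/-- `{A₁, A₂} ≤_tc {B₁, B₂}` as classes (either pairing of the structures). -/
def TcPairs {τ₁ τ₂ σ₁ σ₂ : Type} (r₁ : τ₁ → τ₁ → Prop) (r₂ : τ₂ → τ₂ → Prop)
    (s₁ : σ₁ → σ₁ → Prop) (s₂ : σ₂ → σ₂ → Prop) : Prop :=
  TcPair r₁ r₂ s₁ s₂ ∨ TcPair r₁ r₂ s₂ s₁

/-- The structure `(τ, r)` has a computable copy. -/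
def ComputablyPresentable {τ : Type} (r : τ → τ → Prop) : Prop :=
  ∃ L : Diag, IsCopyR r L ∧
    ∃ f : ℕ → Bool, Computable f ∧ ∀ n, f n = true ↔ n ∈ DiagCode L

/-- Every finite substructure of `(τ, r)` embeds into `(σ, s)`. -/
def FinEmbedIn {τ σ : Type} (r : τ → τ → Prop) (s : σ → σ → Prop) : Prop :=
  ∀ F : Set τ, F.Finite → ∃ g : τ → σ, Set.InjOn g F ∧
    ∀ x ∈ F, ∀ y ∈ F, (r x y ↔ s (g x) (g y))

/-- `A ≡₁ B` : `A` and `B` satisfy the same existential sentences; equivalently,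
every finite substructure of one embeds into the other. -/
def Equiv1 {τ σ : Type} (r : τ → τ → Prop) (s : σ → σ → Prop) : Prop :=
  FinEmbedIn r s ∧ FinEmbedIn s r

/-- `(τ, r)` and `(σ, s)` are isomorphic. -/
def Isom {τ σ : Type} (r : τ → τ → Prop) (s : σ → σ → Prop) : Prop :=
  ∃ e : τ ≃ σ, ∀ x y : τ, (r x y ↔ s (e x) (e y))

open scoped Classical in
theorem ComputablePred.comp {α β : Type*} [Primcodable α] [Primcodable β] {p : β → Prop}
    {f : α → β} (hp : ComputablePred p) (hf : Computable f) : ComputablePred fun a => p (f a) :=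
  Computable.computablePred (hp.decide.comp hf)

open scoped Classical in
theorem ComputablePred.and {α : Type*} [Primcodable α] {p q : α → Prop}
    (hp : ComputablePred p) (hq : ComputablePred q) : ComputablePred fun a => p a ∧ q a :=
  Computable.computablePred ((Primrec.and.to_comp.comp hp.decide hq.decide).of_eq fun a => by simp)

theorem ComputablePred.imp {α : Type*} [Primcodable α] {p q : α → Prop}
    (hp : ComputablePred p) (hq : ComputablePred q) : ComputablePred fun a => p a → q a :=
  (hp.and hq.not).not.of_eq fun a => by tauto

theorem ComputablePred.iff {α : Type*} [Primcodable α] {p q : α → Prop}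
    (hp : ComputablePred p) (hq : ComputablePred q) : ComputablePred fun a => (p a ↔ q a) :=
  ((hp.imp hq).and (hq.imp hp)).of_eq fun a => by tauto

theorem ComputablePred.eq {α β : Type*} [Primcodable α] [Primcodable β] {f g : α → β}
    (hf : Computable f) (hg : Computable g) : ComputablePred fun a => f a = g a :=
  (Primrec.eq (α := β)).computablePred.comp (hf.pair hg)

theorem ComputablePred.lt {α : Type*} [Primcodable α] {f g : α → ℕ}
    (hf : Computable f) (hg : Computable g) : ComputablePred fun a => f a < g a :=
  Primrec.nat_lt.computablePred.comp (hf.pair hg)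

open scoped Classical in
theorem ComputablePred.forall_lt {α : Type*} [Primcodable α] {P : α → ℕ → Prop} {f : α → ℕ}
    (hP : ComputablePred fun p : α × ℕ => P p.1 p.2) (hf : Computable f) :
    ComputablePred fun a => ∀ k < f a, P a k := by
  have h : Computable₂ fun (a : α) (q : ℕ × Bool) => q.2 && decide (P a q.1) :=
    Primrec.and.to_comp.comp (Computable.snd.comp Computable.snd)
      (hP.decide.comp (Computable.fst.pair (Computable.fst.comp Computable.snd)))
  refine Computable.computablePred
    ((Computable.nat_rec hf (Computable.const true) h).of_eq fun a => ?_)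
  induction f a with
  | zero => simp
  | succ n ih => simp only [ih, Nat.forall_lt_succ_right, Bool.decide_and]

theorem ComputablePred.exists_lt {α : Type*} [Primcodable α] {P : α → ℕ → Prop} {f : α → ℕ}
    (hP : ComputablePred fun p : α × ℕ => P p.1 p.2) (hf : Computable f) :
    ComputablePred fun a => ∃ k < f a, P a k :=
  (ComputablePred.forall_lt (P := fun a k => ¬ P a k) hP.not hf).not.of_eq fun a => by
    push Not; rfl

theorem Computable.list_getD {α β : Type*} [Primcodable α] [Primcodable β] (d : β)
    {f : α → List β} {g : α → ℕ} (hf : Computable f) (hg : Computable g) :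
    Computable fun a => (f a).getD (g a) d :=
  (Primrec.list_getD d).to_comp.comp hf hg

/-- A computable relation all of whose sections are nonempty has a computable choice function. -/
theorem ComputablePred.exists_choice {α γ : Type*} [Primcodable α] [Primcodable γ] [Inhabited γ]
    {P : α → γ → Prop} (hP : ComputablePred fun p : α × γ => P p.1 p.2)
    (hex : ∀ a, ∃ x, P a x) : ∃ f : α → γ, Computable f ∧ ∀ a, P a (f a) := by
  classical
  let dec : ℕ → γ := fun n => (Encodable.decode n).getD default
  have hdec : Computable dec := Computable.option_getD Computable.decode (Computable.const default)
  have hex' : ∀ a, ∃ n, P a (dec n) := fun a => by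
    obtain ⟨x, hx⟩ := hex a
    exact ⟨Encodable.encode x, by simpa [dec] using hx⟩
  have hc : ComputablePred fun p : α × ℕ => P p.1 (dec p.2) :=
    hP.comp (Computable.fst.pair (hdec.comp Computable.snd))
  exact ⟨fun a => dec (Nat.find (hex' a)), hdec.comp (Computable.find hc hex'),
    fun a => Nat.find_spec (hex' a)⟩

open scoped Classical in
/-- An infinite computable set of naturals has a computable bijective enumeration. -/
theorem ComputablePred.exists_enum {p : ℕ → Prop} (hp : ComputablePred p)
    (hinf : {n | p n}.Infinite) :
    ∃ e : ℕ → ℕ, Computable e ∧ Function.Injective e ∧ Set.range e = {n | p n} := by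
  have hcount : Computable fun n => Nat.count p n := by
    have h : Computable₂ fun (_ : ℕ) (q : ℕ × ℕ) => q.2 + cond (decide (p q.1)) 1 0 :=
      Primrec.nat_add.to_comp.comp (Computable.snd.comp Computable.snd)
        ((hp.decide.comp (Computable.fst.comp Computable.snd)).cond
          (Computable.const 1) (Computable.const 0))
    refine (Computable.nat_rec Computable.id (Computable.const 0) h).of_eq fun a => ?_
    induction a with
    | zero => simp
    | succ n ih =>
      simp only [id] at ih ⊢
      rw [ih, Nat.count_succ]
      by_cases hn : p n <;> simp [hn]
  have hP : ComputablePred fun q : ℕ × ℕ => p q.2 ∧ Nat.count p q.2 = q.1 :=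
    (hp.comp Computable.snd).and (.eq (hcount.comp Computable.snd) Computable.fst)
  obtain ⟨e, he, hspec⟩ := ComputablePred.exists_choice
    (P := fun n k => p k ∧ Nat.count p k = n) hP fun n =>
      ⟨Nat.nth p n, Nat.nth_mem_of_infinite hinf n, Nat.count_nth_of_infinite hinf n⟩
  refine ⟨e, he, fun i j hij => ?_, ?_⟩
  · rw [← (hspec i).2, ← (hspec j).2, hij]
  · ext k
    constructor
    · rintro ⟨n, rfl⟩
      exact (hspec n).1
    · intro hk
      exact ⟨Nat.count p k, Nat.count_injective (hspec _).1 hk (hspec _).2⟩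

/-- An infinite computably presentable structure has a computable copy with domain `ℕ`. -/
theorem ComputablyPresentable.exists_equiv_nat {τ : Type} [Infinite τ] {r : τ → τ → Prop}
    (h : ComputablyPresentable r) :
    ∃ (a : ℕ → ℕ → Bool) (E : τ ≃ ℕ), Computable₂ a ∧ ∀ x y, (r x y ↔ a (E x) (E y) = true) := by
  obtain ⟨L, ⟨f, hf, hrange, hrel⟩, χ, hχ, hcode⟩ := h
  have hdouble : Computable fun n : ℕ => 2 * n :=
    Primrec.nat_mul.to_comp.comp (Computable.const 2) Computable.id
  have hdom : ∀ n, χ (2 * n) = true ↔ n ∈ L.dom := fun n => by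
    simp [hcode, DiagCode]
  have hpair : ∀ i ∈ L.dom, ∀ j ∈ L.dom,
      (χ (2 * Nat.pair i j + 1) = true ↔ L.rel i j) := fun i hi j hj => by
    have h2 : (2 * Nat.pair i j + 1) / 2 = Nat.pair i j := by omega
    simp [hcode, DiagCode, h2, hi, hj]
  have hinf : {n | n ∈ L.dom}.Infinite := by
    change L.dom.Infinite
    rw [← hrange]
    exact Set.infinite_range_of_injective hf
  have hcdom : ComputablePred fun n => n ∈ L.dom :=
    (ComputablePred.eq (hχ.comp hdouble) (Computable.const true)).of_eq hdom
  obtain ⟨e, he, heinj, herange⟩ := hcdom.exists_enum hinf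
  have hmem : ∀ n, e n ∈ L.dom := fun n => by
    have := Set.mem_range_self (f := e) n
    rwa [herange] at this
  have heq : Set.range f = Set.range e := by rw [hrange, herange]; rfl
  let E : τ ≃ ℕ := (Equiv.ofInjective f hf).trans
    ((Equiv.setCongr heq).trans (Equiv.ofInjective e heinj).symm)
  have hE : ∀ x, e (E x) = f x := fun x => by
    have := Equiv.apply_ofInjective_symm heinj (Equiv.setCongr heq (Equiv.ofInjective f hf x))
    simpa [E] using this
  refine ⟨fun i j => χ (2 * Nat.pair (e i) (e j) + 1), E, ?_, fun x y => ?_⟩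
  · exact hχ.comp (Computable.succ.comp (hdouble.comp (Primrec₂.natPair.to_comp.comp
      (he.comp Computable.fst) (he.comp Computable.snd))))
  · rw [hpair _ (hmem _) _ (hmem _), hE, hE, hrel]

/-- Among the answers of `h` below `s`, the number `k` appears to be an element of the domain with
no element `y` for which the fact coded by `2 * q y k + 1` holds. -/
def LooksExtremal (q : ℕ → ℕ → ℕ) (h : ℕ → Bool) (s k : ℕ) : Prop :=
  (2 * k < s ∧ h (2 * k) = true) ∧ ∀ y < s, ¬ (2 * q y k + 1 < s ∧ h (2 * q y k + 1) = true)

/-- On the basis of the answers of `h` below `s`, the order looks more like `ω` than like `ω*`: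
some apparent minimum has a smaller code than every apparent maximum. -/
def LooksOmega (h : ℕ → Bool) (s : ℕ) : Prop :=
  ∃ k < s, LooksExtremal (fun y x => Nat.pair y x) h s k ∧
    ∀ j < k, ¬ LooksExtremal (fun y x => Nat.pair x y) h s j

theorem looksExtremal_congr {q : ℕ → ℕ → ℕ} {h h' : ℕ → Bool} {s : ℕ} (hh : ∀ i < s, h i = h' i)
    (k : ℕ) : LooksExtremal q h s k ↔ LooksExtremal q h' s k := by
  have key : ∀ i, (i < s ∧ h i = true) ↔ (i < s ∧ h' i = true) := fun i =>
    and_congr_right fun hi => by rw [hh i hi]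
  simp only [LooksExtremal, key]

theorem looksOmega_congr {h h' : ℕ → Bool} {s : ℕ} (hh : ∀ i < s, h i = h' i) :
    LooksOmega h s ↔ LooksOmega h' s := by
  simp only [LooksOmega, looksExtremal_congr hh]

theorem computablePred_looksExtremal {q : ℕ → ℕ → ℕ} (hq : Computable₂ q) :
    ComputablePred fun p : (List Bool × ℕ) × ℕ =>
      LooksExtremal q (fun i => p.1.1.getD i false) p.1.2 p.2 := by
  have hdouble : Computable fun n : ℕ => 2 * n :=
    Primrec.nat_mul.to_comp.comp (Computable.const 2) Computable.id
  have hbit : ComputablePred fun p : (List Bool × ℕ) × ℕ =>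
      p.2 < p.1.2 ∧ p.1.1.getD p.2 false = true :=
    (ComputablePred.lt .snd (Computable.snd.comp .fst)).and
      (.eq (Computable.list_getD false (Computable.fst.comp .fst) .snd) (Computable.const true))
  refine (hbit.comp (Computable.fst.pair (hdouble.comp .snd))).and
    (ComputablePred.forall_lt (P := fun (p : (List Bool × ℕ) × ℕ) y =>
      ¬ (2 * q y p.2 + 1 < p.1.2 ∧ p.1.1.getD (2 * q y p.2 + 1) false = true)) ?_
      (Computable.snd.comp .fst))
  exact (hbit.comp ((Computable.fst.comp .fst).pair (Computable.succ.comp (hdouble.comp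
    (hq.comp .snd (Computable.snd.comp .fst)))))).not

theorem computablePred_looksOmega :
    ComputablePred fun p : List Bool × ℕ => LooksOmega (fun i => p.1.getD i false) p.2 := by
  have h₁ := computablePred_looksExtremal (q := fun y x => Nat.pair y x)
    Primrec₂.natPair.to_comp
  have h₂ := computablePred_looksExtremal (q := fun y x => Nat.pair x y)
    (Primrec₂.natPair.to_comp.comp Computable.snd Computable.fst)
  refine ComputablePred.exists_lt (P := fun (p : List Bool × ℕ) k =>
    LooksExtremal (fun y x => Nat.pair y x) (fun i => p.1.getD i false) p.2 k ∧
      ∀ j < k, ¬ LooksExtremal (fun y x => Nat.pair x y) (fun i => p.1.getD i false) p.2 j)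
    (h₁.and (ComputablePred.forall_lt (P := fun (p : (List Bool × ℕ) × ℕ) j =>
      ¬ LooksExtremal (fun y x => Nat.pair x y) (fun i => p.1.1.getD i false) p.1.2 j)
      ?_ .snd)) .snd
  exact (h₂.comp ((Computable.fst.comp .fst).pair .snd)).not

open Filter in
theorem eventually_looksExtremal {q : ℕ → ℕ → ℕ} {h : ℕ → Bool} {k : ℕ} (hk : h (2 * k) = true)
    (hq : ∀ y, h (2 * q y k + 1) ≠ true) : ∀ᶠ s in atTop, LooksExtremal q h s k := by
  filter_upwards [eventually_gt_atTop (2 * k)] with s hs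
  exact ⟨⟨hs, hk⟩, fun y _ hy => hq y hy.2⟩

open Filter in
theorem eventually_not_looksExtremal {q : ℕ → ℕ → ℕ} {h : ℕ → Bool} {k : ℕ}
    (hk : h (2 * k) = true → ∃ y, h (2 * q y k + 1) = true) :
    ∀ᶠ s in atTop, ¬ LooksExtremal q h s k := by
  by_cases hb : h (2 * k) = true
  · obtain ⟨y, hy⟩ := hk hb
    filter_upwards [eventually_gt_atTop y, eventually_gt_atTop (2 * q y k + 1)] with s hs hs'
    exact fun hx => hx.2 y hs ⟨hs', hy⟩
  · exact Eventually.of_forall fun s hx => hb hx.1.2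

theorem CharOf.two_mul {L : Diag} {X : ℕ → Bool} (hX : CharOf L X) (k : ℕ) :
    X (2 * k) = true ↔ k ∈ L.dom := by
  simp [hX (2 * k), DiagCode]

theorem CharOf.two_mul_pair_add_one {L : Diag} {X : ℕ → Bool} (hX : CharOf L X) (i j : ℕ) :
    X (2 * Nat.pair i j + 1) = true ↔ i ∈ L.dom ∧ j ∈ L.dom ∧ L.rel i j := by
  have h2 : (2 * Nat.pair i j + 1) / 2 = Nat.pair i j := by omega
  simp [hX (2 * Nat.pair i j + 1), DiagCode, h2]

open Filter in
theorem eventually_looksOmega {L : Diag} {X : ℕ → Bool}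
    (hL : IsCopyR ((· < ·) : ℕ → ℕ → Prop) L) (hX : CharOf L X) :
    ∀ᶠ s in atTop, LooksOmega X s := by
  obtain ⟨f, -, hrange, hrel⟩ := hL
  have hf : ∀ i, f i ∈ L.dom := fun i => hrange ▸ Set.mem_range_self i
  have hmin : ∀ᶠ s in atTop, LooksExtremal (fun y x => Nat.pair y x) X s (f 0) := by
    refine eventually_looksExtremal ((hX.two_mul _).2 (hf 0)) fun y hy => ?_
    obtain ⟨hy, -, hy0⟩ := (hX.two_mul_pair_add_one _ _).1 hy
    obtain ⟨i, rfl⟩ := hrange ▸ hy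
    exact Nat.not_lt_zero _ ((hrel i 0).1 hy0)
  have hmax : ∀ᶠ s in atTop, ∀ j ∈ Set.Iio (f 0),
      ¬ LooksExtremal (fun y x => Nat.pair x y) X s j := by
    refine (eventually_all_finite (Set.finite_Iio _)).2 fun j _ =>
      eventually_not_looksExtremal fun hj => ?_
    obtain ⟨i, rfl⟩ := hrange ▸ (hX.two_mul _).1 hj
    exact ⟨f (i + 1), (hX.two_mul_pair_add_one _ _).2
      ⟨hf _, hf _, (hrel _ _).2 (Nat.lt_succ_self i)⟩⟩
  filter_upwards [hmin, hmax, eventually_gt_atTop (f 0)] with s h₁ h₂ h₃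
  exact ⟨f 0, h₃, h₁, h₂⟩

open Filter in
theorem eventually_not_looksOmega {L : Diag} {X : ℕ → Bool}
    (hL : IsCopyR ((· > ·) : ℕ → ℕ → Prop) L) (hX : CharOf L X) :
    ∀ᶠ s in atTop, ¬ LooksOmega X s := by
  obtain ⟨f, -, hrange, hrel⟩ := hL
  have hf : ∀ i, f i ∈ L.dom := fun i => hrange ▸ Set.mem_range_self i
  have hmax : ∀ᶠ s in atTop, LooksExtremal (fun y x => Nat.pair x y) X s (f 0) := by
    refine eventually_looksExtremal ((hX.two_mul _).2 (hf 0)) fun y hy => ?_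
    obtain ⟨-, hy, hy0⟩ := (hX.two_mul_pair_add_one _ _).1 hy
    obtain ⟨i, rfl⟩ := hrange ▸ hy
    exact Nat.not_lt_zero _ ((hrel 0 i).1 hy0)
  have hmin : ∀ᶠ s in atTop, ∀ k ∈ Set.Iic (f 0),
      ¬ LooksExtremal (fun y x => Nat.pair y x) X s k := by
    refine (eventually_all_finite (Set.finite_Iic _)).2 fun j _ =>
      eventually_not_looksExtremal fun hj => ?_
    obtain ⟨i, rfl⟩ := hrange ▸ (hX.two_mul _).1 hj
    exact ⟨f (i + 1), (hX.two_mul_pair_add_one _ _).2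
      ⟨hf _, hf _, (hrel _ _).2 (Nat.lt_succ_self i)⟩⟩
  filter_upwards [hmin, hmax] with s h₁ h₂
  rintro ⟨k, -, hk, hk'⟩
  rcases le_or_gt k (f 0) with h | h
  · exact h₁ k h hk
  · exact hk' _ h h₂

/-- The tuples `e` in `c g` and `l` in `c g'` have the same atomic type. -/
def SameAtomicType (c : Bool → ℕ → ℕ → Bool) (g : Bool) (e : List ℕ) (g' : Bool) (l : List ℕ) :
    Prop :=
  l.length = e.length ∧ ∀ i < e.length, ∀ j < e.length,
    (l.getD i 0 = l.getD j 0 ↔ e.getD i 0 = e.getD j 0) ∧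
      c g' (l.getD i 0) (l.getD j 0) = c g (e.getD i 0) (e.getD j 0)

theorem SameAtomicType.refl (c : Bool → ℕ → ℕ → Bool) (g : Bool) (e : List ℕ) :
    SameAtomicType c g e g e :=
  ⟨rfl, fun _ _ _ _ => ⟨Iff.rfl, rfl⟩⟩

theorem SameAtomicType.map {c : Bool → ℕ → ℕ → Bool} {g g' : Bool} {e : List ℕ} {f : ℕ → ℕ}
    (hinj : ∀ x ∈ e, ∀ y ∈ e, f x = f y → x = y)
    (hf : ∀ x ∈ e, ∀ y ∈ e, c g' (f x) (f y) = c g x y) :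
    SameAtomicType c g e g' (e.map f) := by
  refine ⟨by simp, fun i hi j hj => ?_⟩
  have hi' : i < (e.map f).length := by simpa using hi
  have hj' : j < (e.map f).length := by simpa using hj
  have mi := List.getElem_mem hi
  have mj := List.getElem_mem hj
  simp only [List.getD_eq_getElem _ _ hi, List.getD_eq_getElem _ _ hj,
    List.getD_eq_getElem _ _ hi', List.getD_eq_getElem _ _ hj', List.getElem_map]
  exact ⟨⟨hinj _ mi _ mj, fun h => by rw [h]⟩, hf _ mi _ mj⟩

theorem List.nodup_iff_getD {l : List ℕ} :
    l.Nodup ↔ ∀ i < l.length, ∀ j < l.length, l.getD i 0 = l.getD j 0 → i = j := by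
  rw [List.nodup_iff_injective_get]
  constructor
  · intro h i hi j hj hij
    rw [List.getD_eq_getElem _ _ hi, List.getD_eq_getElem _ _ hj] at hij
    simpa using @h ⟨i, hi⟩ ⟨j, hj⟩ hij
  · rintro h ⟨i, hi⟩ ⟨j, hj⟩ hij
    simp only [Fin.mk.injEq]
    exact h i hi j hj (by
      rw [List.getD_eq_getElem _ _ hi, List.getD_eq_getElem _ _ hj]
      exact hij)

theorem SameAtomicType.nodup {c : Bool → ℕ → ℕ → Bool} {g g' : Bool} {e l : List ℕ}
    (h : SameAtomicType c g e g' l) (he : e.Nodup) : l.Nodup := by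
  rw [List.nodup_iff_getD] at he ⊢
  intro i hi j hj hij
  rw [h.1] at hi hj
  exact he i hi j hj ((h.2 i hi j hj).1.1 hij)

/-- If every tuple of each structure is realised in each structure, then realisations can be found
computably, and can be chosen equal to the given tuple when the structure does not change. -/
theorem exists_computable_transfer {c : Bool → ℕ → ℕ → Bool}
    (hc : Computable fun p : Bool × ℕ × ℕ => c p.1 p.2.1 p.2.2)
    (hex : ∀ g e g', ∃ l, SameAtomicType c g e g' l) :
    ∃ move : (Bool × List ℕ) × Bool → List ℕ, Computable move ∧
      ∀ g e g', SameAtomicType c g e g' (move ((g, e), g')) ∧ move ((g, e), g) = e := by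
  have hc' : ∀ {α : Type} [Primcodable α] {f : α → Bool} {u v : α → ℕ}, Computable f →
      Computable u → Computable v → Computable fun a => c (f a) (u a) (v a) :=
    fun hf hu hv => hc.comp (hf.pair (hu.pair hv))
  have hP : ComputablePred fun p : ((Bool × List ℕ) × Bool) × List ℕ =>
      SameAtomicType c p.1.1.1 p.1.1.2 p.1.2 p.2 ∧ (p.1.1.1 = p.1.2 → p.2 = p.1.1.2) := by
    have hg : Computable fun p : ((Bool × List ℕ) × Bool) × List ℕ => p.1.1.1 :=
      Computable.fst.comp (Computable.fst.comp .fst)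
    have he : Computable fun p : ((Bool × List ℕ) × Bool) × List ℕ => p.1.1.2 :=
      Computable.snd.comp (Computable.fst.comp .fst)
    have hg' : Computable fun p : ((Bool × List ℕ) × Bool) × List ℕ => p.1.2 :=
      Computable.snd.comp .fst
    have hlen := Computable.list_length.comp he
    refine ComputablePred.and (ComputablePred.and
      (.eq (Computable.list_length.comp .snd) hlen) ?_)
      ((ComputablePred.eq hg hg').imp (.eq .snd he))
    refine ComputablePred.forall_lt (P := fun (p : ((Bool × List ℕ) × Bool) × List ℕ) i =>
      ∀ j < p.1.1.2.length,
        (p.2.getD i 0 = p.2.getD j 0 ↔ p.1.1.2.getD i 0 = p.1.1.2.getD j 0) ∧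
          c p.1.2 (p.2.getD i 0) (p.2.getD j 0) =
            c p.1.1.1 (p.1.1.2.getD i 0) (p.1.1.2.getD j 0)) ?_ hlen
    refine ComputablePred.forall_lt
      (P := fun (q : (((Bool × List ℕ) × Bool) × List ℕ) × ℕ) j =>
        (q.1.2.getD q.2 0 = q.1.2.getD j 0 ↔ q.1.1.1.2.getD q.2 0 = q.1.1.1.2.getD j 0) ∧
          c q.1.1.2 (q.1.2.getD q.2 0) (q.1.2.getD j 0) =
            c q.1.1.1.1 (q.1.1.1.2.getD q.2 0) (q.1.1.1.2.getD j 0)) ?_ (hlen.comp .fst)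
    have h₀ : Computable fun r : ((((Bool × List ℕ) × Bool) × List ℕ) × ℕ) × ℕ => r.1.1 :=
      Computable.fst.comp .fst
    have hi : Computable fun r : ((((Bool × List ℕ) × Bool) × List ℕ) × ℕ) × ℕ => r.1.2 :=
      Computable.snd.comp .fst
    have hli := Computable.list_getD 0 (Computable.snd.comp h₀) hi
    have hlj := Computable.list_getD 0 (Computable.snd.comp h₀) .snd
    have hei := Computable.list_getD 0 (he.comp h₀) hi
    have hej := Computable.list_getD 0 (he.comp h₀) .snd
    exact ((ComputablePred.eq hli hlj).iff (.eq hei hej)).and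
      (.eq (hc' (hg'.comp h₀) hli hlj) (hc' (hg.comp h₀) hei hej))
  obtain ⟨move, hmove, hspec⟩ := ComputablePred.exists_choice
    (P := fun (a : (Bool × List ℕ) × Bool) l =>
      SameAtomicType c a.1.1 a.1.2 a.2 l ∧ (a.1.1 = a.2 → l = a.1.2)) hP (by
    rintro ⟨⟨g, e⟩, g'⟩
    by_cases h : g = g'
    · subst h
      exact ⟨e, .refl c g e, fun _ => rfl⟩
    · obtain ⟨l, hl⟩ := hex g e g'
      exact ⟨l, hl, fun h' => absurd h' h⟩)
  exact ⟨move, hmove, fun g e g' => ⟨(hspec _).1, (hspec ((g, e), g)).2 rfl⟩⟩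

/-- The least natural number outside a list can be computed. -/
theorem exists_computable_fresh : ∃ fresh : List ℕ → ℕ, Computable fresh ∧
    ∀ l, fresh l ∉ l ∧ ∀ k < fresh l, k ∈ l := by
  classical
  have hmem : ComputablePred fun p : List ℕ × ℕ => p.2 ∈ p.1 := by
    refine (ComputablePred.exists_lt (P := fun (p : List ℕ × ℕ) i => p.1[i]? = some p.2)
      (f := fun p => p.1.length) ?_ (Computable.list_length.comp .fst)).of_eq fun p => ?_
    · exact .eq (Computable.list_getElem?.comp (Computable.fst.comp .fst) .snd)
        (Computable.option_some.comp (Computable.snd.comp .fst))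
    · rw [List.mem_iff_getElem?]
      exact ⟨fun ⟨i, _, h⟩ => ⟨i, h⟩, fun ⟨i, h⟩ => ⟨i, (List.getElem?_eq_some_iff.1 h).1, h⟩⟩
  have hP : ComputablePred fun p : List ℕ × ℕ => p.2 ∉ p.1 ∧ ∀ k < p.2, k ∈ p.1 :=
    hmem.not.and (ComputablePred.forall_lt (P := fun (p : List ℕ × ℕ) k => k ∈ p.1)
      (hmem.comp ((Computable.fst.comp .fst).pair .snd)) .snd)
  refine ComputablePred.exists_choice (P := fun (l : List ℕ) n => n ∉ l ∧ ∀ k < n, k ∈ l) hP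
    fun l => ?_
  have hex : ∃ n, n ∉ l := Infinite.exists_notMem_finset l.toFinset |>.imp fun n hn => by
    simpa using hn
  exact ⟨Nat.find hex, Nat.find_spec hex, fun k hk => not_not.1 (Nat.find_min hex hk)⟩

open scoped Classical in
/-- The guess whether the order presented by `h` is `ω`, as a Boolean. -/
noncomputable def omegaGuess (h : ℕ → Bool) (s : ℕ) : Bool :=
  decide (LooksOmega h s)

theorem omegaGuess_congr {h h' : ℕ → Bool} {s : ℕ} (hh : ∀ i < s, h i = h' i) :
    omegaGuess h s = omegaGuess h' s := by
  unfold omegaGuess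
  congr 1
  exact propext (looksOmega_congr hh)

theorem computable_omegaGuess :
    Computable fun p : List Bool × ℕ => omegaGuess (fun i => p.1.getD i false) p.2 := by
  classical
  exact computablePred_looksOmega.decide

/-- One step of the construction: transfer the tuple to the guessed structure by `move`, and
extend it by a fresh element. -/
def extendTuple (move : (Bool × List ℕ) × Bool → List ℕ) (fresh : List ℕ → ℕ)
    (p : (Bool × List ℕ) × Bool) : Bool × List ℕ :=
  (p.2, move p ++ [fresh (move p)])

/-- The stages of the construction: the current guess, and a tuple of the guessed structure. -/
noncomputable def stage (move : (Bool × List ℕ) × Bool → List ℕ) (fresh : List ℕ → ℕ)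
    (h : ℕ → Bool) : ℕ → Bool × List ℕ
  | 0 => (true, [])
  | s + 1 => extendTuple move fresh (stage move fresh h s, omegaGuess h s)

section Stage

variable {c : Bool → ℕ → ℕ → Bool} {move : (Bool × List ℕ) × Bool → List ℕ} {fresh : List ℕ → ℕ}

theorem stage_congr {h h' : ℕ → Bool} {s : ℕ} (hh : ∀ i < s, h i = h' i) :
    stage move fresh h s = stage move fresh h' s := by
  induction s with
  | zero => rfl
  | succ s ih =>
    have hh' : ∀ i < s, h i = h' i := fun i hi => hh i (hi.trans (Nat.lt_succ_self s))
    simp only [stage, ih hh', omegaGuess_congr hh']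

theorem computable_stage (hmove : Computable move) (hfresh : Computable fresh) :
    Computable fun p : List Bool × ℕ => stage move fresh (fun i => p.1.getD i false) p.2 := by
  have hext : Computable (extendTuple move fresh) :=
    Computable.snd.pair (Computable.list_concat.comp hmove (hfresh.comp hmove))
  have hguess : Computable fun q : (List Bool × ℕ) × ℕ × (Bool × List ℕ) =>
      omegaGuess (fun i => q.1.1.getD i false) q.2.1 := by
    have hpair : Computable fun q : (List Bool × ℕ) × ℕ × (Bool × List ℕ) => (q.1.1, q.2.1) :=
      (Computable.fst.comp .fst).pair (Computable.fst.comp .snd)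
    have hcomp := computable_omegaGuess.comp hpair
    exact hcomp
  have hstep : Computable₂ fun (p : List Bool × ℕ) (q : ℕ × (Bool × List ℕ)) =>
      extendTuple move fresh (q.2, omegaGuess (fun i => p.1.getD i false) q.1) :=
    hext.comp ((Computable.snd.comp .snd).pair hguess)
  refine (Computable.nat_rec .snd (Computable.const (true, [])) hstep).of_eq fun p => ?_
  induction p.2 with
  | zero => rfl
  | succ s ih => simp only [stage, ih]

theorem length_stage (hmove : ∀ g e g', SameAtomicType c g e g' (move ((g, e), g')))
    (h : ℕ → Bool) (s : ℕ) : (stage move fresh h s).2.length = s := by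
  induction s with
  | zero => rfl
  | succ s ih => simp only [stage, extendTuple, List.length_append, (hmove _ _ _).1, ih, List.length_singleton]

theorem nodup_stage (hmove : ∀ g e g', SameAtomicType c g e g' (move ((g, e), g')))
    (hfresh : ∀ l, fresh l ∉ l) (h : ℕ → Bool) (s : ℕ) : (stage move fresh h s).2.Nodup := by
  induction s with
  | zero => exact List.nodup_nil
  | succ s ih =>
    rw [stage, extendTuple, ← List.concat_eq_append]
    exact ((hmove _ _ _).nodup ih).concat (hfresh _)

theorem stage_rel_eq (hmove : ∀ g e g', SameAtomicType c g e g' (move ((g, e), g')))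
    (h : ℕ → Bool) {s t i j : ℕ} (hst : s ≤ t) (hi : i < s) (hj : j < s) :
    c (stage move fresh h t).1 ((stage move fresh h t).2.getD i 0)
        ((stage move fresh h t).2.getD j 0) =
      c (stage move fresh h s).1 ((stage move fresh h s).2.getD i 0)
        ((stage move fresh h s).2.getD j 0) := by
  induction t, hst using Nat.le_induction with
  | base => rfl
  | succ t hst ih =>
    rw [← ih]
    have hlen := length_stage (fresh := fresh) hmove h t
    have hm := hmove (stage move fresh h t).1 (stage move fresh h t).2 (omegaGuess h t)
    have hi' := hi.trans_le hst
    have hj' := hj.trans_le hst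
    have := hm.2 i (hlen.symm ▸ hi') j (hlen.symm ▸ hj')
    simp only [stage, extendTuple]
    rw [List.getD_append _ _ _ _ (by rw [hm.1, hlen]; exact hi'),
      List.getD_append _ _ _ _ (by rw [hm.1, hlen]; exact hj')]
    exact this.2

open Filter in
/-- If the guesses stabilise, then the tuples converge to a permutation of the naturals. -/
theorem exists_limit_stage (hmove : ∀ g e g', SameAtomicType c g e g' (move ((g, e), g')))
    (hstay : ∀ g e, move ((g, e), g) = e)
    (hfresh : ∀ l, fresh l ∉ l ∧ ∀ k < fresh l, k ∈ l) {h : ℕ → Bool} {g : Bool}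
    (hg : ∀ᶠ s in atTop, omegaGuess h s = g) :
    ∃ t : ℕ ≃ ℕ, ∀ i, ∀ᶠ s in atTop,
      (stage move fresh h s).1 = g ∧ (stage move fresh h s).2.getD i 0 = t i := by
  obtain ⟨s₀, hs₀⟩ := eventually_atTop.1 hg
  have hlen := length_stage (fresh := fresh) hmove h
  have hguess : ∀ s ≥ s₀ + 1, (stage move fresh h s).1 = g := by
    rintro (_ | s) hs
    · omega
    · exact hs₀ s (by omega)
  have hsucc : ∀ s ≥ s₀ + 1, (stage move fresh h (s + 1)).2 =
      (stage move fresh h s).2 ++ [fresh (stage move fresh h s).2] := fun s hs => by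
    have h₁ : omegaGuess h s = (stage move fresh h s).1 := by
      rw [hguess s hs, hs₀ s (by omega)]
    have h₂ := hstay (stage move fresh h s).1 (stage move fresh h s).2
    simp only [Prod.mk.eta] at h₂
    simp only [stage, extendTuple, h₁, h₂]
  have hpre : ∀ s s', s₀ + 1 ≤ s → s ≤ s' → ∀ i < s,
      (stage move fresh h s').2.getD i 0 = (stage move fresh h s).2.getD i 0 := by
    intro s s' hs hss i hi
    induction s', hss using Nat.le_induction with
    | base => rfl
    | succ s' hss ih =>
      rw [hsucc s' (hs.trans hss), List.getD_append _ _ _ _ (by rw [hlen]; omega), ih]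
  let t : ℕ → ℕ := fun i => (stage move fresh h (max (i + 1) (s₀ + 1))).2.getD i 0
  have ht : ∀ s i, s₀ + 1 ≤ s → i < s → (stage move fresh h s).2.getD i 0 = t i :=
    fun s i hs hi => hpre _ _ (le_max_right _ _) (max_le hi hs) i
      (lt_of_lt_of_le (Nat.lt_succ_self i) (le_max_left _ _))
  have hinj : Function.Injective t := fun i j hij => by
    have hnd := List.nodup_iff_getD.1
      (nodup_stage hmove (fun l => (hfresh l).1) h (i + j + s₀ + 1))
    refine hnd i (by rw [hlen]; omega) j (by rw [hlen]; omega) ?_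
    rw [ht _ i (by omega) (by omega), ht _ j (by omega) (by omega), hij]
  have hsurj : Function.Surjective t := by
    by_contra hns
    obtain ⟨n, hn⟩ := not_forall.1 hns
    have hle : Set.MapsTo t (Set.Ici (s₀ + 1)) (Set.Iic n) := fun s hs => by
      have hs' : s₀ + 1 ≤ s := hs
      have hts : t s = fresh (stage move fresh h s).2 := by
        rw [← ht (s + 1) s (by omega) (Nat.lt_succ_self s), hsucc s hs',
          List.getD_append_right _ _ _ _ (by rw [hlen]), hlen]
        simp
      rw [Set.mem_Iic, hts]
      by_contra hlt
      obtain ⟨i, hi, hin⟩ := List.mem_iff_getElem.1 ((hfresh _).2 n (not_le.1 hlt))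
      refine hn ⟨i, ?_⟩
      rw [← ht s i hs' (by rwa [hlen] at hi), List.getD_eq_getElem _ _ hi, hin]
    exact Set.infinite_of_injOn_mapsTo hinj.injOn hle (Set.Ici_infinite _) (Set.finite_Iic n)
  refine ⟨Equiv.ofBijective t ⟨hinj, hsurj⟩, fun i => ?_⟩
  filter_upwards [eventually_ge_atTop (s₀ + 1), eventually_gt_atTop i] with s hs hi
  exact ⟨hguess s hs, ht s i hs hi⟩

/-- The functional reading off the diagram of the structure under construction from its stages. -/
noncomputable def stageFunctional (c : Bool → ℕ → ℕ → Bool)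
    (move : (Bool × List ℕ) × Bool → List ℕ) (fresh : List ℕ → ℕ) (σ : List Bool) (n : ℕ) :
    Option Bool :=
  bif n.bodd then
    bif decide (n.div2.unpair.1 < σ.length ∧ n.div2.unpair.2 < σ.length) then
      some (c (stage move fresh (fun i => σ.getD i false) σ.length).1
        ((stage move fresh (fun i => σ.getD i false) σ.length).2.getD n.div2.unpair.1 0)
        ((stage move fresh (fun i => σ.getD i false) σ.length).2.getD n.div2.unpair.2 0))
    else none
  else some true

theorem computable_stageFunctional (hc : Computable fun p : Bool × ℕ × ℕ => c p.1 p.2.1 p.2.2)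
    (hmove : Computable move) (hfresh : Computable fresh) :
    Computable₂ (stageFunctional c move fresh) := by
  classical
  have hk : Computable fun p : List Bool × ℕ => p.2.div2.unpair :=
    Computable.unpair.comp (Computable.nat_div2.comp .snd)
  have hlen : Computable fun p : List Bool × ℕ => p.1.length :=
    Computable.list_length.comp .fst
  have hstage : Computable fun p : List Bool × ℕ =>
      stage move fresh (fun i => p.1.getD i false) p.1.length := by
    have hpair : Computable fun p : List Bool × ℕ => (p.1, p.1.length) := Computable.fst.pair hlen
    have hcomp := (computable_stage hmove hfresh).comp hpair
    exact hcomp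
  have hc' : ∀ {f : List Bool × ℕ → Bool} {u v : List Bool × ℕ → ℕ}, Computable f →
      Computable u → Computable v → Computable fun a => c (f a) (u a) (v a) :=
    fun hf hu hv => hc.comp (hf.pair (hu.pair hv))
  have hval := Computable.option_some.comp (hc' (Computable.fst.comp hstage)
    (Computable.list_getD 0 (Computable.snd.comp hstage) (Computable.fst.comp hk))
    (Computable.list_getD 0 (Computable.snd.comp hstage) (Computable.snd.comp hk)))
  have hlt : ComputablePred fun p : List Bool × ℕ =>
      p.2.div2.unpair.1 < p.1.length ∧ p.2.div2.unpair.2 < p.1.length :=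
    (ComputablePred.lt (Computable.fst.comp hk) hlen).and (.lt (Computable.snd.comp hk) hlen)
  exact (Computable.nat_bodd.comp .snd).cond
    (hlt.decide.cond hval (Computable.const none))
    (Computable.const (some true))

theorem stageFunctional_mono (hmove : ∀ g e g', SameAtomicType c g e g' (move ((g, e), g')))
    {σ τ : List Bool} {n : ℕ} {b : Bool} (hστ : σ <+: τ)
    (h : stageFunctional c move fresh σ n = some b) :
    stageFunctional c move fresh τ n = some b := by
  unfold stageFunctional at h ⊢
  cases hn : n.bodd
  · simpa [hn] using h
  · have hle := hστ.length_le
    by_cases hlt : n.div2.unpair.1 < σ.length ∧ n.div2.unpair.2 < σ.length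
    · have hlt' : n.div2.unpair.1 < τ.length ∧ n.div2.unpair.2 < τ.length :=
        ⟨hlt.1.trans_le hle, hlt.2.trans_le hle⟩
      have hagree : ∀ i < σ.length, τ.getD i false = σ.getD i false := fun i hi => by
        obtain ⟨ρ, rfl⟩ := hστ
        exact List.getD_append _ _ _ _ hi
      simp only [hn, hlt, hlt', and_self, decide_true, cond_true] at h ⊢
      rw [stage_rel_eq hmove _ hle hlt.1 hlt.2, stage_congr hagree]
      exact h
    · simp [hn, hlt] at h

open Filter in
theorem stageFunctional_sends (hmove : ∀ g e g', SameAtomicType c g e g' (move ((g, e), g')))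
    (hstay : ∀ g e, move ((g, e), g) = e)
    (hfresh : ∀ l, fresh l ∉ l ∧ ∀ k < fresh l, k ∈ l)
    {T : TOp} (hT : T.φ = stageFunctional c move fresh) {X : ℕ → Bool} {g : Bool}
    (hg : ∀ᶠ s in atTop, omegaGuess X s = g)
    {τ : Type} {r : τ → τ → Prop} (E : τ ≃ ℕ) (hE : ∀ x y, (r x y ↔ c g (E x) (E y) = true)) :
    ∃ (M : Diag) (Y : ℕ → Bool), IsCopyR r M ∧ CharOf M Y ∧ T.Sends X Y := by
  obtain ⟨t, ht⟩ := exists_limit_stage hmove hstay hfresh hg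
  let M : Diag := ⟨Set.univ, fun i j => c g (t i) (t j) = true⟩
  refine ⟨M, fun n => bif n.bodd then c g (t n.div2.unpair.1) (t n.div2.unpair.2) else true,
    ⟨fun x => t.symm (E x), t.symm.injective.comp E.injective,
      (t.symm.surjective.comp E.surjective).range_eq, fun i j => by simp [M, hE]⟩,
    fun n => ?_, fun n => ?_⟩
  · have hodd : Odd n ↔ n.bodd = true := by
      rw [Nat.odd_iff, Nat.mod_two_of_bodd]
      cases n.bodd <;> simp
    cases hn : n.bodd <;> simp [DiagCode, M, hodd, hn, Nat.div2_val, -Nat.not_odd_iff_even]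
  · obtain ⟨s, ⟨hgs, hi⟩, ⟨-, hj⟩, his, hjs⟩ :=
      ((ht n.div2.unpair.1).and ((ht n.div2.unpair.2).and
        ((eventually_gt_atTop n.div2.unpair.1).and
          (eventually_gt_atTop n.div2.unpair.2)))).exists
    refine ⟨(List.range s).map X, fun i hi => by simp, ?_⟩
    have hX : ∀ i < s, ((List.range s).map X).getD i false = X i := fun i hi => by
      rw [List.getD_eq_getElem _ _ (by simpa using hi)]
      simp
    rw [hT, stageFunctional]
    simp only [List.length_map, List.length_range, stage_congr hX, hgs, hi, hj, his, hjs,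
      and_self, decide_true, cond_true]
    cases n.bodd <;> rfl

end Stage

/-- A finite embeddability condition, transported to copies with domain `ℕ`. -/
theorem FinEmbedIn.exists_sameAtomicType {τ τ' : Type} {r : τ → τ → Prop} {r' : τ' → τ' → Prop}
    (h : FinEmbedIn r r') {c : Bool → ℕ → ℕ → Bool} {g g' : Bool} {E : τ ≃ ℕ} {E' : τ' ≃ ℕ}
    (hE : ∀ x y, (r x y ↔ c g (E x) (E y) = true))
    (hE' : ∀ x y, (r' x y ↔ c g' (E' x) (E' y) = true)) (e : List ℕ) :
    ∃ l, SameAtomicType c g e g' l := by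
  obtain ⟨f, hinj, hf⟩ := h {x | E x ∈ e} (e.finite_toSet.preimage E.injective.injOn)
  refine ⟨e.map fun n => E' (f (E.symm n)), .map (fun x hx y hy hxy => ?_) fun x hx y hy => ?_⟩
  · exact E.symm.injective (hinj (by simpa using hx) (by simpa using hy) (E'.injective hxy))
  · have := hf (E.symm x) (by simpa using hx) (E.symm y) (by simpa using hy)
    rw [hE, hE', E.apply_symm_apply, E.apply_symm_apply] at this
    exact Bool.eq_iff_iff.2 this.symm

/-- if `A` and `B` are infinite, non-isomorphic, computably
presentable structures in the same language with `A ≡₁ B`, then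
`{ω, ω*} ≤_tc {A, B}`. -/
theorem omega_pair_below {A B : Type} [Countable A] [Countable B]
    [Infinite A] [Infinite B] (rA : A → A → Prop) (rB : B → B → Prop)
    (hniso : ¬ Isom rA rB)
    (hcA : ComputablyPresentable rA) (hcB : ComputablyPresentable rB)
    (h1 : Equiv1 rA rB) :
    TcPair ((· < ·) : ℕ → ℕ → Prop) ((· > ·) : ℕ → ℕ → Prop) rA rB := by
  classical
  obtain ⟨a, EA, ha, hEA⟩ := hcA.exists_equiv_nat
  obtain ⟨b, EB, hb, hEB⟩ := hcB.exists_equiv_nat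
  let c : Bool → ℕ → ℕ → Bool := fun g i j => bif g then a i j else b i j
  have hc : Computable fun p : Bool × ℕ × ℕ => c p.1 p.2.1 p.2.2 :=
    Computable.fst.cond (ha.comp (Computable.fst.comp .snd) (Computable.snd.comp .snd))
      (hb.comp (Computable.fst.comp .snd) (Computable.snd.comp .snd))
  have hex : ∀ g e g', ∃ l, SameAtomicType c g e g' l := by
    rintro (_ | _) e (_ | _)
    · exact ⟨e, .refl c _ e⟩
    · exact h1.2.exists_sameAtomicType hEB hEA e
    · exact h1.1.exists_sameAtomicType hEA hEB e
    · exact ⟨e, .refl c _ e⟩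
  obtain ⟨move, hmovec, hmove⟩ := exists_computable_transfer hc hex
  obtain ⟨fresh, hfreshc, hfresh⟩ := exists_computable_fresh
  have hm := fun g e g' => (hmove g e g').1
  have hs := fun g e => (hmove g e g).2
  refine ⟨⟨stageFunctional c move fresh, computable_stageFunctional hc hmovec hfreshc,
    fun _ _ _ _ => stageFunctional_mono hm⟩, fun L X hL hX => ?_, fun L X hL hX => ?_⟩
  · exact stageFunctional_sends hm hs hfresh rfl (g := true)
      ((eventually_looksOmega hL hX).mono fun s h => decide_eq_true h) EA hEA
  · exact stageFunctional_sends hm hs hfresh rfl (g := false)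
      ((eventually_not_looksOmega hL hX).mono fun s h => decide_eq_false h) EB hEB
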